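/- The operator L : 𝒜₀ → 𝒜_ps-c is bijective, and its inverse is given by the explicit formula L⁻¹ g = g − Eis(CT g) for g ∈ 𝒜_ps-c (the expression makes sense because CT g ∈ C₊). Moreover, for every g ∈ 𝒜_ps-c one has CT(g − Eis(CT g)) = −M(CT g) ∈ C₋, so g − Eis(CT g) indeed lies in 𝒜₀. (Proposition 'p:A'(ii) of the paper, including identity (4.4) from its proof.) -/

import Mathlib

/-- Proposition `p:A`(ii) of the paper, including identity (4.4) from its proof:
the operator `L : 𝒜₀ → 𝒜_ps-c`, `L f = f - Eis (M⁻¹ (CT f))`, is bijective,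
with inverse `L' g = g - Eis (CT g)` for `g ∈ 𝒜_ps-c` (which makes sense since
`CT g ∈ C₊`).  Moreover for every `g ∈ 𝒜_ps-c` one has
`CT (g - Eis (CT g)) = - M (CT g) ∈ C₋`, so `g - Eis (CT g)` indeed lies in `𝒜₀`.
This is expressed by: `L` maps `𝒜₀` into `𝒜_ps-c` and `L' ∘ L = id` on `𝒜₀`;
`L'` maps `𝒜_ps-c` into `𝒜₀` with `CT (L' g) = - M (CT g)`, and `L ∘ L' = id`
on `𝒜_ps-c`. -/
theorem stmt_1 {E 𝒜 𝒞 : Type*} [Field E]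
    [AddCommGroup 𝒜] [Module E 𝒜] [AddCommGroup 𝒞] [Module E 𝒞]
    (Cp Cm : Submodule E 𝒞)
    (CT : 𝒜 →ₗ[E] 𝒞) (Eis : Cp →ₗ[E] 𝒜) (M : Cp ≃ₗ[E] Cm)
    (hCTEis : ∀ φ : Cp, CT (Eis φ) = (φ : 𝒞) + ((M φ : Cm) : 𝒞)) :
    (∀ (f : 𝒜) (hf : CT f ∈ Cm),
      ∃ h1 : CT (f - Eis (M.symm ⟨CT f, hf⟩)) ∈ Cp,
        (f - Eis (M.symm ⟨CT f, hf⟩)) -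
          Eis ⟨CT (f - Eis (M.symm ⟨CT f, hf⟩)), h1⟩ = f) ∧
    (∀ (g : 𝒜) (hg : CT g ∈ Cp),
      CT (g - Eis ⟨CT g, hg⟩) = -((M ⟨CT g, hg⟩ : Cm) : 𝒞) ∧
      ∃ h2 : CT (g - Eis ⟨CT g, hg⟩) ∈ Cm,
        (g - Eis ⟨CT g, hg⟩) -
          Eis (M.symm ⟨CT (g - Eis ⟨CT g, hg⟩), h2⟩) = g) := by
  refine ⟨fun f hf => ?_, fun g hg => ?_⟩
  · have hCT : CT (f - Eis (M.symm ⟨CT f, hf⟩)) = ((-M.symm ⟨CT f, hf⟩ : Cp) : 𝒞) := by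
      simp [hCTEis]
    have h1 : CT (f - Eis (M.symm ⟨CT f, hf⟩)) ∈ Cp := hCT ▸ Subtype.property _
    have hsub : (⟨_, h1⟩ : Cp) = -M.symm ⟨CT f, hf⟩ := Subtype.ext hCT
    refine ⟨h1, ?_⟩
    rw [hsub, map_neg, sub_neg_eq_add, sub_add_cancel]
  · have hCT : CT (g - Eis ⟨CT g, hg⟩) = ((-M ⟨CT g, hg⟩ : Cm) : 𝒞) := by
      simp [hCTEis]
    have h2 : CT (g - Eis ⟨CT g, hg⟩) ∈ Cm := hCT ▸ Subtype.property _
    have hsub : (⟨_, h2⟩ : Cm) = -M ⟨CT g, hg⟩ := Subtype.ext hCT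
    refine ⟨hCT, h2, ?_⟩
    rw [hsub, map_neg, M.symm_apply_apply, map_neg, sub_neg_eq_add, sub_add_cancel]
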